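/- arXiv:0905.2413 — 4 statements merged into one kernel-verified Lean document; each statement's English description precedes it below -/
import Mathlib

section
/- For a dying channel with i.i.d. fading power gains, the outage probability can always be reduced (weakly) by rearranging the power allocation vector into non-increasing order: for every power allocation vector P = (P_1,…,P_K) with P_i ≥ 0 there exists a permutation σ of {1,…,K} such that the rearranged vector (P_{σ(1)},…,P_{σ(K)}) is non-increasing and p_out(P_{σ(1)},…,P_{σ(K)}) ≤ p_out(P_1,…,P_K). Hence an optimal power allocation profile is non-increasing. (Theorem 1.) -/
open MeasureTheory ProbabilityTheory Real Finset

/-- The information accumulated over the first `l` blocks at gains `a` and powers `Q`,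
normalised by the coding length. -/
noncomputable def blockRate {K : ℕ} (l : ℕ) (Q a : Fin K → ℝ) : ℝ :=
  (1 / (K : ℝ)) * ∑ k : Fin K, (if (k : ℕ) < l then Real.log (1 + a k * Q k) else 0)

lemma measurable_blockRate {K : ℕ} (Q : Fin K → ℝ) :
    Measurable (fun p : (Fin K → ℝ) × ℕ => blockRate p.2 Q p.1) := by
  unfold blockRate
  refine (Finset.measurable_sum _ fun k _ => ?_).const_mul _
  refine Measurable.ite (measurableSet_lt measurable_const measurable_snd) ?_ measurable_const
  fun_prop

lemma blockRate_comp_perm {K : ℕ} {l : ℕ} (Q a : Fin K → ℝ) (τ : Equiv.Perm (Fin K))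
    (hτ : ∀ k, (τ k : ℕ) < l ↔ (k : ℕ) < l) :
    blockRate l (Q ∘ τ) (a ∘ τ) = blockRate l Q a := by
  unfold blockRate
  congr 1
  rw [← Equiv.sum_comp τ fun k : Fin K => if (k : ℕ) < l then Real.log (1 + a k * Q k) else 0]
  simp [hτ]

lemma blockRate_mono {K : ℕ} {l : ℕ} {Q Q' a : Fin K → ℝ} (hQ : ∀ k, 0 ≤ Q k)
    (ha : ∀ k, 0 ≤ a k) (h : ∀ k : Fin K, (k : ℕ) < l → Q k ≤ Q' k) :
    blockRate l Q a ≤ blockRate l Q' a := by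
  unfold blockRate
  refine mul_le_mul_of_nonneg_left (Finset.sum_le_sum fun k _ => ?_) (by positivity)
  split_ifs with hk
  · have h1 := mul_nonneg (ha k) (hQ k)
    have h2 := mul_le_mul_of_nonneg_left (h k hk) (ha k)
    exact Real.log_le_log (by linarith) (by linarith)
  · rfl

/-- Independent identically distributed families are exchangeable. -/
lemma map_comp_perm_eq {Ω ι : Type*} [Fintype ι] [MeasurableSpace Ω] {μ : Measure Ω}
    [IsProbabilityMeasure μ] {α : ι → Ω → ℝ} (hαmeas : ∀ i, Measurable (α i))
    (hαindep : iIndepFun α μ) (hαident : ∀ i j, IdentDistrib (α i) (α j) μ μ)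
    (τ : Equiv.Perm ι) :
    μ.map (fun ω i => α (τ i) ω) = μ.map (fun ω i => α i ω) := by
  have h := (iIndepFun_iff_map_fun_eq_pi_map fun i => (hαmeas i).aemeasurable).1 hαindep
  have h' := (iIndepFun_iff_map_fun_eq_pi_map fun i => (hαmeas (τ i)).aemeasurable).1
    (hαindep.precomp τ.injective)
  rw [h, h']
  congr 1
  exact funext fun i => (hαident (τ i) i).map_eq

lemma measure_blockRate_swap_le {Ω : Type*} [MeasurableSpace Ω] {μ : Measure Ω}
    [IsProbabilityMeasure μ] {K : ℕ} {α : Fin K → Ω → ℝ} (hαmeas : ∀ i, Measurable (α i))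
    (hαnonneg : ∀ i ω, 0 ≤ α i ω) (hαindep : iIndepFun α μ)
    (hαident : ∀ i j, IdentDistrib (α i) (α j) μ μ) (R : ℝ) (l : ℕ)
    {Q : Fin K → ℝ} (hQ : ∀ k, 0 ≤ Q k) {i j : Fin K} (hij : i < j) (hlt : Q i < Q j) :
    μ {ω | blockRate l (Q ∘ Equiv.swap i j) (fun k => α k ω) < R}
      ≤ μ {ω | blockRate l Q (fun k => α k ω) < R} := by
  have hij' : (i : ℕ) < j := hij
  by_cases hj : (j : ℕ) < l
  · have hτ : ∀ k, (Equiv.swap i j k : ℕ) < l ↔ (k : ℕ) < l := by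
      intro k
      rw [Equiv.swap_apply_def]
      split_ifs with h1 h2
      · subst h1; omega
      · subst h2; omega
      · rfl
    have hmeas : MeasurableSet {a : Fin K → ℝ | blockRate l (Q ∘ Equiv.swap i j) a < R} :=
      measurableSet_lt ((measurable_blockRate _).comp
        (measurable_id.prodMk measurable_const)) measurable_const
    have h := congrArg (fun ν => ν {a : Fin K → ℝ | blockRate l (Q ∘ Equiv.swap i j) a < R})
      (map_comp_perm_eq hαmeas hαindep hαident (Equiv.swap i j))
    rw [Measure.map_apply (measurable_pi_lambda _ fun k => hαmeas _) hmeas,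
      Measure.map_apply (measurable_pi_lambda _ hαmeas) hmeas] at h
    refine h.symm.le.trans (le_of_eq ?_)
    congr 1
    ext ω
    have := blockRate_comp_perm Q (fun k => α k ω) (Equiv.swap i j) hτ
    simp only [Set.mem_preimage, Set.mem_ofPred_eq, ← this]
    rfl
  · refine measure_mono fun ω (hω : _ < R) => show _ < R from lt_of_le_of_lt ?_ hω
    refine blockRate_mono hQ (fun k => hαnonneg k ω) fun k hk => ?_
    rw [Function.comp_apply, Equiv.swap_apply_def]
    split_ifs with h1 h2
    · subst h1; exact hlt.le
    · subst h2; exact absurd hk hj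
    · rfl

/-- A comparison of two events for every fixed value of a random parameter `N` independent of `X`
carries over to the random parameter. -/
lemma measure_le_of_forall_of_indepFun {Ω E F : Type*} [MeasurableSpace Ω] [MeasurableSpace E]
    [MeasurableSpace F] {μ : Measure Ω} [IsProbabilityMeasure μ] {X : Ω → E} {N : Ω → F}
    (hX : Measurable X) (hN : Measurable N) (hind : IndepFun X N μ) {A B : Set (E × F)}
    (hA : MeasurableSet A) (hB : MeasurableSet B)
    (h : ∀ n, μ {ω | (X ω, n) ∈ A} ≤ μ {ω | (X ω, n) ∈ B}) :
    μ {ω | (X ω, N ω) ∈ A} ≤ μ {ω | (X ω, N ω) ∈ B} := by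
  have := Measure.isProbabilityMeasure_map (μ := μ) hX.aemeasurable
  have := Measure.isProbabilityMeasure_map (μ := μ) hN.aemeasurable
  have key : ∀ C : Set (E × F), MeasurableSet C →
      μ {ω | (X ω, N ω) ∈ C} = ∫⁻ n, μ {ω | (X ω, n) ∈ C} ∂(μ.map N) := by
    intro C hC
    have hmap := (indepFun_iff_map_prod_eq_prod_map_map hX.aemeasurable hN.aemeasurable).1 hind
    change μ ((fun ω => (X ω, N ω)) ⁻¹' C) = _
    rw [← Measure.map_apply (hX.prodMk hN) hC, hmap, Measure.prod_apply_symm hC]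
    refine lintegral_congr fun n => ?_
    rw [Measure.map_apply hX (measurable_prodMk_right hC)]
    rfl
  rw [key A hA, key B hB]
  exact lintegral_mono h

/-- **Theorem 1 (dying channel, i.i.d. fading): an optimal power allocation is
non-increasing.** For every power allocation vector `P` there is a permutation `σ`
of the blocks such that `P ∘ σ` is non-increasing and the outage probability with
the rearranged powers is no larger than with the original powers. -/
theorem outage_min_by_nonincreasing_power
    {Ω : Type*} [MeasurableSpace Ω] (μ : Measure Ω) [IsProbabilityMeasure μ]
    (K : ℕ) (hK : 0 < K)
    (α : Fin K → Ω → ℝ) (hαmeas : ∀ i, Measurable (α i))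
    (hαnonneg : ∀ i ω, 0 ≤ α i ω)
    (hαindep : iIndepFun α μ)
    (hαident : ∀ i j, IdentDistrib (α i) (α j) μ μ)
    (T : Ω → ℝ) (hTmeas : Measurable T) (hTpos : ∀ ω, 0 < T ω)
    (hTindep : IndepFun (fun ω => fun i => α i ω) T μ)
    (L : Ω → ℕ) (hL : ∀ ω, L ω = min K (Int.toNat ⌊T ω⌋))
    (R : ℝ) (hR : 0 < R)
    (P : Fin K → ℝ) (hP : ∀ i, 0 ≤ P i) :
    ∃ σ : Equiv.Perm (Fin K),
      Antitone (fun k => P (σ k)) ∧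
      μ {ω | (1 / (K : ℝ)) *
            ∑ k : Fin K, (if (k : ℕ) < L ω then Real.log (1 + α k ω * P (σ k)) else 0) < R}
        ≤ μ {ω | (1 / (K : ℝ)) *
            ∑ k : Fin K, (if (k : ℕ) < L ω then Real.log (1 + α k ω * P k) else 0) < R} := by
  have hLfun : L = (fun t : ℝ => min K (Int.toNat ⌊t⌋)) ∘ T := funext hL
  have hfloor : Measurable (fun t : ℝ => min K (Int.toNat ⌊t⌋)) :=
    (measurable_of_countable fun z : ℤ => min K z.toNat).comp Int.measurable_floor
  have hLmeas : Measurable L := hLfun ▸ hfloor.comp hTmeas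
  have hLindep : IndepFun (fun ω i => α i ω) L μ :=
    hLfun ▸ hTindep.comp measurable_id hfloor
  refine ⟨Tuple.sort (OrderDual.toDual ∘ P),
    fun i j hij => Tuple.monotone_sort (OrderDual.toDual ∘ P) hij, ?_⟩
  refine Tuple.bubble_sort_induction' (f := OrderDual.toDual ∘ P)
    (P := fun Q => μ {ω | blockRate (L ω) (OrderDual.ofDual ∘ Q) (fun k => α k ω) < R}
      ≤ μ {ω | blockRate (L ω) P (fun k => α k ω) < R}) le_rfl ?_
  intro σ i j hij hlt hle
  have hmeas (Q : Fin K → ℝ) :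
      MeasurableSet {p : (Fin K → ℝ) × ℕ | blockRate p.2 Q p.1 < R} :=
    measurableSet_lt (measurable_blockRate Q) measurable_const
  exact (measure_le_of_forall_of_indepFun (measurable_pi_lambda _ hαmeas) hLmeas hLindep
    (hmeas ((P ∘ σ) ∘ Equiv.swap i j)) (hmeas (P ∘ σ)) fun l =>
      measure_blockRate_swap_le hαmeas hαnonneg hαindep hαident R l
        (fun k => hP (σ k)) hij hlt).trans hle
end

section
/- Swap step for Theorem 1: for a dying channel with i.i.d. fading power gains, if 1 ≤ i < j ≤ K and P_i < P_j, then the vector P' obtained from P = (P_1,…,P_K) by exchanging the i-th and j-th coordinates satisfies p_out(P') ≤ p_out(P); i.e., moving the larger power to the earlier block does not increase the outage probability. -/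
open MeasureTheory ProbabilityTheory Real Finset

/-- Before the later of the two swapped blocks, swapping the smaller power with the larger one
can only increase the accumulated rate. -/
lemma sum_log_le_sum_log_swap {K n : ℕ} {a P : Fin K → ℝ} (ha : ∀ k, 0 ≤ a k)
    (hP : ∀ k, 0 ≤ P k) {i j : Fin K} (hPij : P i ≤ P j) (hn : n ≤ (j : ℕ)) :
    ∑ k : Fin K, (if (k : ℕ) < n then Real.log (1 + a k * P k) else 0) ≤
      ∑ k : Fin K, (if (k : ℕ) < n then Real.log (1 + a k * P (Equiv.swap i j k)) else 0) := by
  refine Finset.sum_le_sum fun k _ => ?_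
  split_ifs with hk
  · have hkj : k ≠ j := by rintro rfl; omega
    have hle : P k ≤ P (Equiv.swap i j k) := by
      by_cases hki : k = i
      · simpa [hki] using hPij
      · rw [Equiv.swap_apply_of_ne_of_ne hki hkj]
    have := mul_nonneg (ha k) (hP k)
    have := mul_le_mul_of_nonneg_left hle (ha k)
    exact Real.log_le_log (by linarith) (by linarith)
  · exact le_rfl

/-- Once both swapped blocks are used, swapping the powers amounts to swapping the gains. -/
lemma sum_log_swap_eq_sum_log_comp_swap {K n : ℕ} (a P : Fin K → ℝ) {i j : Fin K}
    (hi : (i : ℕ) < n) (hj : (j : ℕ) < n) :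
    ∑ k : Fin K, (if (k : ℕ) < n then Real.log (1 + a k * P (Equiv.swap i j k)) else 0) =
      ∑ k : Fin K, (if (k : ℕ) < n then Real.log (1 + a (Equiv.swap i j k) * P k) else 0) := by
  refine Fintype.sum_equiv (Equiv.swap i j) _ _ fun k => ?_
  rw [Equiv.swap_apply_self]
  have hk : ((Equiv.swap i j k : Fin K) : ℕ) < n ↔ (k : ℕ) < n := by
    rw [Equiv.swap_apply_def]
    split_ifs with h₁ h₂ <;> simp_all
  simp only [hk]

/-- Permuting i.i.d. variables that are jointly independent of `T` preserves their joint law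
with `T`. -/
lemma identDistrib_precomp_prodMk {Ω ι E F : Type*} [Countable ι] [MeasurableSpace Ω]
    [MeasurableSpace E] [MeasurableSpace F] {μ : Measure Ω} [IsProbabilityMeasure μ]
    {X : ι → Ω → E} {T : Ω → F} (hX : iIndepFun X μ)
    (hident : ∀ i j, IdentDistrib (X i) (X j) μ μ) (hT : AEMeasurable T μ)
    (hXT : IndepFun (fun ω i => X i ω) T μ) (σ : Equiv.Perm ι) :
    IdentDistrib (fun ω => ((fun i => X (σ i) ω), T ω)) (fun ω => ((fun i => X i ω), T ω)) μ μ := by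
  have hσ : IndepFun (fun ω i => X (σ i) ω) T μ :=
    hXT.comp (φ := fun x i => x (σ i)) (ψ := id)
      (measurable_pi_lambda _ fun i => measurable_pi_apply (σ i)) measurable_id
  exact (IdentDistrib.pi (fun i => hident (σ i) i) (hX.precomp σ.injective) hX).prodMk
    (IdentDistrib.refl hT) hσ hXT

/-- **Swap step for Theorem 1.** For a dying channel with i.i.d. fading power gains,
if `i < j` and `P i < P j`, then exchanging the `i`-th and `j`-th powers (moving the
larger power to the earlier block) does not increase the outage probability. -/
theorem outage_swap_step
    {Ω : Type*} [MeasurableSpace Ω] (μ : Measure Ω) [IsProbabilityMeasure μ]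
    (K : ℕ) (hK : 0 < K)
    (α : Fin K → Ω → ℝ) (hαmeas : ∀ i, Measurable (α i))
    (hαnonneg : ∀ i ω, 0 ≤ α i ω)
    (hαindep : iIndepFun α μ)
    (hαident : ∀ i j, IdentDistrib (α i) (α j) μ μ)
    (T : Ω → ℝ) (hTmeas : Measurable T) (hTpos : ∀ ω, 0 < T ω)
    (hTindep : IndepFun (fun ω => fun i => α i ω) T μ)
    (L : Ω → ℕ) (hL : ∀ ω, L ω = min K (Int.toNat ⌊T ω⌋))
    (R : ℝ) (hR : 0 < R)
    (P : Fin K → ℝ) (hP : ∀ i, 0 ≤ P i)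
    (i j : Fin K) (hij : i < j) (hPij : P i < P j) :
    μ {ω | (1 / (K : ℝ)) *
          ∑ k : Fin K,
            (if (k : ℕ) < L ω then Real.log (1 + α k ω * P (Equiv.swap i j k)) else 0) < R}
      ≤ μ {ω | (1 / (K : ℝ)) *
          ∑ k : Fin K, (if (k : ℕ) < L ω then Real.log (1 + α k ω * P k) else 0) < R} := by
  obtain rfl : L = fun ω => min K (Int.toNat ⌊T ω⌋) := funext hL
  let ℓ : ℝ → ℕ := fun t => min K (Int.toNat ⌊t⌋)
  have hℓ : Measurable ℓ :=
    (measurable_from_top (f := fun z : ℤ => min K z.toNat)).comp Int.measurable_floor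
  have hE : MeasurableSet {ω | (j : ℕ) < ℓ (T ω)} :=
    measurableSet_lt measurable_const (hℓ.comp hTmeas)
  have hB : MeasurableSet {x : (Fin K → ℝ) × ℝ | (1 / (K : ℝ)) *
      ∑ k : Fin K, (if (k : ℕ) < ℓ x.2 then Real.log (1 + x.1 k * P k) else 0) < R ∧
        (j : ℕ) < ℓ x.2} := by
    have hlt (m : ℕ) : MeasurableSet {x : (Fin K → ℝ) × ℝ | m < ℓ x.2} :=
      measurableSet_lt measurable_const (hℓ.comp measurable_snd)
    have hrate : Measurable fun x : (Fin K → ℝ) × ℝ => (1 / (K : ℝ)) *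
        ∑ k : Fin K, (if (k : ℕ) < ℓ x.2 then Real.log (1 + x.1 k * P k) else 0) := by
      refine .const_mul (Finset.measurable_sum _ fun k _ => ?_) _
      exact .ite (hlt k) (by fun_prop) measurable_const
    exact (measurableSet_lt hrate measurable_const).inter (hlt j)
  have hlaw := (identDistrib_precomp_prodMk hαindep hαident hTmeas.aemeasurable hTindep
    (Equiv.swap i j)).measure_mem_eq hB
  rw [← measure_inter_add_sdiff _ hE, ← measure_inter_add_sdiff {ω | _ * _ < R} hE]
  refine add_le_add (le_of_eq ?_) (measure_mono ?_)
  · refine Eq.trans (congrArg μ ?_) hlaw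
    ext ω
    refine and_congr_left fun hω => ?_
    have hj : (j : ℕ) < ℓ (T ω) := hω
    have hsum := sum_log_swap_eq_sum_log_comp_swap (fun k => α k ω) P
      (lt_trans (Fin.lt_def.mp hij) hj) hj
    exact iff_of_eq (congrArg (fun s => 1 / (K : ℝ) * s < R) hsum)
  · rintro ω ⟨hω, hj⟩
    exact ⟨(mul_le_mul_of_nonneg_left (sum_log_le_sum_log_swap (fun k => hαnonneg k ω) hP hPij.le
      (not_lt.mp hj)) (by positivity)).trans_lt hω, hj⟩
end

section
/- Upper bound on the outage probability with uniform power allocation: for a dying channel with i.i.d. fading power gains with CDF F, uniform power P > 0 per block, coding length K, and rate R > 0, Pr{ (1/K)·Σ_{i=1}^{L} log(1+α_i P) < R } ≤ w_0 + Σ_{i=1}^{K−1} [ F( (e^{KR} − 1)/P ) ]^i · w_i + [ F( (e^{KR} − 1)/P ) ]^K · w_K*, where w_0 = Pr{T ≤ 1}, w_i = Pr{ i < T ≤ i+1 } for 1 ≤ i ≤ K−1, and w_K* = Pr{ T > K }. -/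
open MeasureTheory ProbabilityTheory Real Finset

/-- The probability that the first `i` of `K` i.i.d. variables lie below `c`, jointly with an
event of an independent variable `T`. -/
lemma measureReal_forall_lt_inter_preimage {Ω : Type*} [MeasurableSpace Ω] {μ : Measure Ω}
    {K : ℕ} {α : Fin K → Ω → ℝ} (hαindep : iIndepFun α μ)
    {T : Ω → ℝ} (hTindep : IndepFun (fun ω => fun i => α i ω) T μ) {c p : ℝ}
    (hp : ∀ i, p = (μ {ω | α i ω < c}).toReal) {i : ℕ} (hi : i ≤ K)
    {S : Set ℝ} (hS : MeasurableSet S) :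
    μ.real ({ω | ∀ k : Fin K, (k : ℕ) < i → α k ω < c} ∩ T ⁻¹' S) =
      p ^ i * μ.real (T ⁻¹' S) := by
  have hA : MeasurableSet {x : Fin K → ℝ | ∀ k : Fin K, (k : ℕ) < i → x k < c} := by
    simp only [Set.ofPred_forall]
    exact MeasurableSet.iInter fun k => MeasurableSet.iInter fun _ =>
      measurableSet_lt (measurable_pi_apply k) measurable_const
  have hcard : #{k : Fin K | (k : ℕ) < i} = i := by
    simp [Fin.card_filter_val_lt, hi]
  have hprod : μ.real {ω | ∀ k : Fin K, (k : ℕ) < i → α k ω < c} = p ^ i := by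
    have h := hαindep.measure_inter_preimage_eq_mul {k : Fin K | (k : ℕ) < i}
      (sets := fun _ => Set.Iio c) (fun _ _ => measurableSet_Iio)
    have hset : {ω | ∀ k : Fin K, (k : ℕ) < i → α k ω < c} =
        ⋂ k ∈ ({k : Fin K | (k : ℕ) < i} : Finset (Fin K)), α k ⁻¹' Set.Iio c := by
      ext ω
      simp
    rw [hset, Measure.real, h, ENNReal.toReal_prod]
    calc _ = ∏ _k ∈ ({k : Fin K | (k : ℕ) < i} : Finset (Fin K)), p :=
          prod_congr rfl fun k _ => (hp k).symm
      _ = p ^ i := by rw [prod_const, hcard]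
  rw [← hprod]
  have h := hTindep.measure_inter_preimage_eq_mul _ _ hA hS
  simpa [Measure.real] using congrArg ENNReal.toReal h

/-- If a sum of nonnegative rates `log (1 + x k * P)` over the active blocks stays below `K * R`,
then so does each term, which bounds the gain of every active block. -/
lemma lt_of_sum_log_lt {K : ℕ} (hK : 0 < K) {x : Fin K → ℝ} (hx : ∀ k, 0 ≤ x k) {l : ℕ}
    {P R : ℝ} (hP : 0 < P)
    (h : (1 / (K : ℝ)) *
      ∑ k : Fin K, (if (k : ℕ) < l then Real.log (1 + x k * P) else 0) < R)
    {k : Fin K} (hk : (k : ℕ) < l) : x k < (Real.exp ((K : ℝ) * R) - 1) / P := by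
  have hK' : (0 : ℝ) < K := by exact_mod_cast hK
  have hpos : ∀ j, 0 ≤ x j * P := fun j => mul_nonneg (hx j) hP.le
  have hterm := single_le_sum
    (f := fun k : Fin K => if (k : ℕ) < l then Real.log (1 + x k * P) else 0)
    (fun j _ => by
      split_ifs
      · exact Real.log_nonneg (by linarith [hpos j])
      · exact le_rfl) (mem_univ k)
  simp only [hk, if_true] at hterm
  rw [one_div_mul_eq_div, div_lt_iff₀' hK'] at h
  have := (Real.log_lt_iff_lt_exp (by linarith [hpos k])).1 (hterm.trans_lt h)
  rw [lt_div_iff₀ hP]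
  linarith

/-- **Upper bound on the outage probability with uniform power allocation.**
For a dying channel with i.i.d. fading power gains with (strict-inequality) CDF `F`,
uniform power `P > 0`, coding length `K` and rate `R > 0`,
`p_out ≤ w_0 + Σ_{i=1}^{K−1} [F((e^{KR}−1)/P)]^i w_i + [F((e^{KR}−1)/P)]^K w_K*`. -/
theorem outage_upper_bound_uniform_power
    {Ω : Type*} [MeasurableSpace Ω] (μ : Measure Ω) [IsProbabilityMeasure μ]
    (K : ℕ) (hK : 0 < K)
    (α : Fin K → Ω → ℝ) (hαmeas : ∀ i, Measurable (α i))
    (hαnonneg : ∀ i ω, 0 ≤ α i ω)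
    (hαindep : iIndepFun α μ)
    (hαident : ∀ a b, IdentDistrib (α a) (α b) μ μ)
    (F : ℝ → ℝ) (hF : ∀ i x, F x = (μ {ω | α i ω < x}).toReal)
    (T : Ω → ℝ) (hTmeas : Measurable T) (hTpos : ∀ ω, 0 < T ω)
    (hTindep : IndepFun (fun ω => fun i => α i ω) T μ)
    (L : Ω → ℕ) (hL : ∀ ω, L ω = min K (Int.toNat ⌊T ω⌋))
    (P R : ℝ) (hP : 0 < P) (hR : 0 < R) :
    (μ {ω | (1 / (K : ℝ)) *
          ∑ k : Fin K, (if (k : ℕ) < L ω then Real.log (1 + α k ω * P) else 0) < R}).toReal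
      ≤ (μ {ω | T ω ≤ 1}).toReal
        + ∑ i ∈ Finset.Ico 1 K,
            (F ((Real.exp ((K : ℝ) * R) - 1) / P)) ^ i
              * (μ {ω | (i : ℝ) < T ω ∧ T ω ≤ (i : ℝ) + 1}).toReal
        + (F ((Real.exp ((K : ℝ) * R) - 1) / P)) ^ K * (μ {ω | (K : ℝ) < T ω}).toReal := by
  set c := (Real.exp ((K : ℝ) * R) - 1) / P
  let A : ℕ → Set Ω := fun i => {ω | ∀ k : Fin K, (k : ℕ) < i → α k ω < c}
  have hprob : ∀ i ≤ K, ∀ S : Set ℝ, MeasurableSet S →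
      μ.real (A i ∩ T ⁻¹' S) = F c ^ i * μ.real (T ⁻¹' S) := fun i hi S hS =>
    measureReal_forall_lt_inter_preimage hαindep hTindep (fun j => hF j c) hi hS
  have hsub : {ω | (1 / (K : ℝ)) *
      ∑ k : Fin K, (if (k : ℕ) < L ω then Real.log (1 + α k ω * P) else 0) < R} ⊆
      ({ω | T ω ≤ 1} ∪ ⋃ i ∈ Finset.Ico 1 K, A i ∩ T ⁻¹' Set.Ioc (i : ℝ) (i + 1)) ∪
        (A K ∩ T ⁻¹' Set.Ioi (K : ℝ)) := by
    intro ω hω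
    have hA : ∀ i ≤ K, (i : ℝ) < T ω → ω ∈ A i := fun i hi hiT k hk => by
      refine lt_of_sum_log_lt hK (fun j => hαnonneg j ω) hP hω ?_
      have hfloor : (i : ℤ) ≤ ⌊T ω⌋ := Int.le_floor.2 (by exact_mod_cast hiT.le)
      rw [hL]
      omega
    by_cases h1 : T ω ≤ 1
    · exact Or.inl (Or.inl h1)
    by_cases hKT : (K : ℝ) < T ω
    · exact Or.inr ⟨hA K le_rfl hKT, hKT⟩
    push Not at h1 hKT
    obtain ⟨i, hi⟩ : ∃ i : ℕ, ⌈T ω⌉₊ = i + 1 :=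
      Nat.exists_eq_succ_of_ne_zero (Nat.ceil_pos.2 (hTpos ω)).ne'
    have hlt : (i : ℝ) < T ω := Nat.lt_ceil.1 (by omega)
    have hle : T ω ≤ (i : ℝ) + 1 := by exact_mod_cast hi ▸ Nat.le_ceil (T ω)
    have hi1 : 1 ≤ i := by
      have : (0 : ℝ) < i := by linarith
      exact_mod_cast this
    have hiK : i < K := by exact_mod_cast hlt.trans_le hKT
    exact Or.inl (Or.inr (Set.mem_biUnion (Finset.mem_coe.2 (Finset.mem_Ico.2 ⟨hi1, hiK⟩))
      ⟨hA i hiK.le hlt, hlt, hle⟩))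
  refine (measureReal_mono hsub).trans ((measureReal_union_le _ _).trans
    (add_le_add ((measureReal_union_le _ _).trans (add_le_add le_rfl
      ((measureReal_biUnion_finset_le _ _).trans (sum_le_sum fun i hi => ?_)))) ?_))
  · exact (hprob i (Finset.mem_Ico.1 hi).2.le _ measurableSet_Ioc).le
  · exact (hprob K le_rfl _ measurableSet_Ioi).le
end

section
/- Central limit theorem for strictly stationary m-dependent sequences (Hoeffding–Robbins): suppose {X_n, n ≥ 1} is a strictly stationary m-dependent sequence of real random variables with E(X_i) = μ and Var(X_i) = σ² < ∞. Then, as N → ∞, (1/√N)·Σ_{i=1}^{N} (X_i − μ) converges in distribution to the normal law N(0, υ_m), where υ_m = σ² + 2·Σ_{i=1}^{m} Cov(X_t, X_{t+i}). -/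
open MeasureTheory ProbabilityTheory Real Finset

theorem norm_charFun_map_sub_le {Ω : Type*} [MeasurableSpace Ω] {P : Measure Ω}
    [IsProbabilityMeasure P] {U V : Ω → ℝ} (hU : AEMeasurable U P) (hV : AEMeasurable V P)
    (hUV : Integrable (fun ω => U ω - V ω) P) (t : ℝ) :
    ‖charFun (P.map U) t - charFun (P.map V) t‖ ≤ |t| * ∫ ω, |U ω - V ω| ∂P := by
  have hexp (W : Ω → ℝ) (hW : AEMeasurable W P) :
      Integrable (fun ω => Complex.exp (t * W ω * Complex.I)) P := by
    refine Integrable.of_bound (C := 1) (by fun_prop) (.of_forall fun ω => ?_)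
    rw [← Complex.ofReal_mul, Complex.norm_exp_ofReal_mul_I]
  rw [charFun_apply_real, charFun_apply_real, integral_map hU (by fun_prop),
    integral_map hV (by fun_prop), ← integral_sub (hexp U hU) (hexp V hV), ← integral_const_mul]
  refine norm_integral_le_of_norm_le (hUV.abs.const_mul _) (.of_forall fun ω => ?_)
  have hfac : Complex.exp (t * U ω * Complex.I) - Complex.exp (t * V ω * Complex.I) =
      Complex.exp ((t * V ω : ℝ) * Complex.I) *
        (Complex.exp (Complex.I * (t * (U ω - V ω) : ℝ)) - 1) := by
    rw [mul_sub, ← Complex.exp_add]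
    push_cast
    ring_nf
  rw [hfac, norm_mul, Complex.norm_exp_ofReal_mul_I, one_mul, ← abs_mul]
  exact norm_exp_I_mul_ofReal_sub_one_le

theorem integral_abs_le_sqrt_integral_sq {Ω : Type*} [MeasurableSpace Ω] {P : Measure Ω}
    [IsProbabilityMeasure P] {Z : Ω → ℝ} (hZ : MemLp Z 2 P) :
    ∫ ω, |Z ω| ∂P ≤ √(∫ ω, Z ω ^ 2 ∂P) := by
  apply Real.le_sqrt_of_sq_le
  have h := variance_nonneg |Z| P
  rw [variance_eq_sub hZ.abs] at h
  simpa using h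

theorem tendsto_charFun_inv_sqrt_mul_pow_of_integral_eq_zero {Ω : Type*} [MeasurableSpace Ω]
    {P : Measure Ω} [IsProbabilityMeasure P] {Z : Ω → ℝ} (hZ : MemLp Z 2 P)
    (h0 : ∫ ω, Z ω ∂P = 0) (t : ℝ) :
    Filter.Tendsto (fun n : ℕ => charFun (P.map Z) ((√n)⁻¹ * t) ^ n) Filter.atTop
      (nhds (Complex.exp ((-((∫ ω, Z ω ^ 2 ∂P) * t ^ 2 / 2) : ℝ)))) := by
  have hmeas : AEMeasurable Z P := hZ.aestronglyMeasurable.aemeasurable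
  set s := ∫ ω, Z ω ^ 2 ∂P with hs
  have hs0 : 0 ≤ s := integral_nonneg fun ω => sq_nonneg _
  obtain h | h := hs0.eq_or_lt'
  · have hae : Z =ᵐ[P] fun _ => 0 := by
      have := (integral_eq_zero_iff_of_nonneg (fun ω => sq_nonneg (Z ω)) hZ.integrable_sq).1 h
      filter_upwards [this] with ω hω
      simpa using hω
    simp [Measure.map_congr hae, h, charFun_dirac]
  · have hr : 0 < √s := Real.sqrt_pos.2 h
    have key := tendsto_charFun_inv_sqrt_mul_pow (P := P) (X := fun ω => (√s)⁻¹ * Z ω)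
      (by fun_prop) (by simp [integral_const_mul, h0])
      (by
        simp only [Pi.pow_apply, mul_pow, integral_const_mul, ← hs, inv_pow, Real.sq_sqrt hs0]
        exact inv_mul_cancel₀ h.ne') (√s * t)
    have hexp : -((√s * t : ℝ) : ℂ) ^ 2 / 2 = ((-(s * t ^ 2 / 2) : ℝ) : ℂ) := by
      rw [← Complex.ofReal_pow, mul_pow, Real.sq_sqrt hs0]
      push_cast
      ring
    rw [hexp] at key
    refine key.congr fun n => ?_
    rw [charFun_map_mul_comp hmeas]
    congr 2
    field_simp

theorem tendsto_of_forall_approx {f : ℕ → ℂ} {G : ℕ → ℕ → ℂ} {h : ℕ → ℂ} {L : ℂ}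
    {d : ℕ → ℕ → ℝ} {e : ℕ → ℝ}
    (hG : ∀ p, Filter.Tendsto (G p) Filter.atTop (nhds (h p)))
    (hh : Filter.Tendsto h Filter.atTop (nhds L))
    (hfG : ∀ p, ∀ᶠ N in Filter.atTop, ‖f N - G p N‖ ≤ d p N)
    (hd : ∀ p, Filter.Tendsto (d p) Filter.atTop (nhds (e p)))
    (he : Filter.Tendsto e Filter.atTop (nhds 0)) :
    Filter.Tendsto f Filter.atTop (nhds L) := by
  rw [Metric.tendsto_nhds]
  intro ε hε
  have h4 : 0 < ε / 4 := by positivity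
  obtain ⟨p, hp1, hp2⟩ :=
    ((he.eventually_lt_const h4).and (Metric.tendsto_nhds.1 hh _ h4)).exists
  filter_upwards [hfG p, (hd p).eventually_lt_const (show e p < ε / 2 by linarith),
    Metric.tendsto_nhds.1 (hG p) _ h4] with N h1 h2 h3
  rw [← dist_eq_norm] at h1
  have t1 := dist_triangle (f N) (G p N) L
  have t2 := dist_triangle (G p N) (h p) L
  linarith

theorem indepFun_sum_of_indep_iSup {Ω : Type*} [MeasurableSpace Ω] {P : Measure Ω}
    [IsProbabilityMeasure P] {m : ℕ} {X : ℕ → Ω → ℝ}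
    (hmdep : ∀ t : ℕ,
      Indep (⨆ j ∈ {j : ℕ | j ≤ t}, MeasurableSpace.comap (X j) inferInstance)
        (⨆ j ∈ {j : ℕ | t + m + 1 ≤ j}, MeasurableSpace.comap (X j) inferInstance) P)
    (c : ℝ) {A B : Finset ℕ} (hAB : ∀ a ∈ A, ∀ b ∈ B, a + m < b) :
    IndepFun (fun ω => ∑ i ∈ A, (X i ω - c)) (fun ω => ∑ i ∈ B, (X i ω - c)) P := by
  have hsum (S : Set ℕ) (A : Finset ℕ) (hA : ∀ a ∈ A, a ∈ S) :
      Measurable[⨆ j ∈ S, MeasurableSpace.comap (X j) inferInstance]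
        fun ω => ∑ i ∈ A, (X i ω - c) := by
    refine Finset.measurable_fun_sum A fun i hi => Measurable.sub_const ?_ c
    exact (comap_measurable (X i)).mono
      (le_iSup₂_of_le (f := fun j (_ : j ∈ S) => MeasurableSpace.comap (X j) inferInstance)
        i (hA i hi) le_rfl) le_rfl
  obtain rfl | hne := A.eq_empty_or_nonempty
  · simpa using indepFun_const_left (0 : ℝ) _
  · rw [IndepFun_iff_Indep]
    refine indep_of_indep_of_le_left (indep_of_indep_of_le_right (hmdep (A.max' hne)) ?_) ?_
    · exact (hsum _ B fun b hb => hAB _ (A.max'_mem hne) b hb).comap_le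
    · exact (hsum _ A fun a ha => A.le_max' a ha).comap_le

/-- The first `k` blocks of `p` consecutive integers separated by gaps of length `m`. -/
def gappedBlocks (p m : ℕ) : ℕ → Finset ℕ
  | 0 => ∅
  | k + 1 => gappedBlocks p m k ∪ Ico (k * (p + m)) (k * (p + m) + p)

theorem add_lt_of_mem_gappedBlocks {p m k i : ℕ} (hi : i ∈ gappedBlocks p m k) :
    i + m < k * (p + m) := by
  induction k with
  | zero => simp [gappedBlocks] at hi
  | succ k ih =>
    rw [gappedBlocks, mem_union, mem_Ico] at hi
    rw [add_one_mul]
    rcases hi with hi | hi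
    · have := ih hi
      omega
    · omega

theorem disjoint_gappedBlocks_Ico (p m k : ℕ) :
    Disjoint (gappedBlocks p m k) (Ico (k * (p + m)) (k * (p + m) + p)) := by
  refine Finset.disjoint_left.2 fun i hi hi' => ?_
  have := add_lt_of_mem_gappedBlocks hi
  rw [mem_Ico] at hi'
  omega

theorem card_gappedBlocks (p m k : ℕ) : #(gappedBlocks p m k) = k * p := by
  induction k with
  | zero => simp [gappedBlocks]
  | succ k ih =>
    rw [gappedBlocks, card_union_of_disjoint (disjoint_gappedBlocks_Ico p m k), ih, Nat.card_Ico]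
    rw [add_one_mul]
    omega

section CenteredSequence

variable {Ω : Type*} [MeasurableSpace Ω] {P : Measure Ω} {Y : ℕ → Ω → ℝ} {m : ℕ}

theorem integral_mul_eq_zero_of_add_lt (hL2 : ∀ i, MemLp (Y i) 2 P)
    (hmean : ∀ i, ∫ ω, Y i ω ∂P = 0)
    (hind : ∀ A B : Finset ℕ, (∀ a ∈ A, ∀ b ∈ B, a + m < b) →
      IndepFun (fun ω => ∑ i ∈ A, Y i ω) (fun ω => ∑ i ∈ B, Y i ω) P)
    {i j : ℕ} (hij : i + m < j) : ∫ ω, Y i ω * Y j ω ∂P = 0 := by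
  have h : IndepFun (Y i) (Y j) P := by
    simpa using hind {i} {j} (by simpa using hij)
  rw [h.integral_fun_mul_eq_mul_integral (hL2 i).aestronglyMeasurable
    (hL2 j).aestronglyMeasurable, hmean i, zero_mul]

theorem integral_sq_sum_le (hL2 : ∀ i, MemLp (Y i) 2 P) {s : ℝ}
    (hs : ∀ i, ∫ ω, Y i ω ^ 2 ∂P = s)
    (hzero : ∀ i j, i + m < j → ∫ ω, Y i ω * Y j ω ∂P = 0) (A : Finset ℕ) :
    ∫ ω, (∑ i ∈ A, Y i ω) ^ 2 ∂P ≤ (2 * m + 1) * s * #A := by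
  have hint (i j : ℕ) : Integrable (fun ω => Y i ω * Y j ω) P := (hL2 i).integrable_mul (hL2 j)
  have hs0 : 0 ≤ s := hs 0 ▸ integral_nonneg fun ω => sq_nonneg _
  have hle (i j : ℕ) : ∫ ω, Y i ω * Y j ω ∂P ≤ s := by
    calc ∫ ω, Y i ω * Y j ω ∂P ≤ ∫ ω, (Y i ω ^ 2 / 2 + Y j ω ^ 2 / 2) ∂P := by
          refine integral_mono (hint i j)
            (((hL2 i).integrable_sq.div_const 2).add ((hL2 j).integrable_sq.div_const 2))
            fun ω => ?_
          dsimp only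
          nlinarith [sq_nonneg (Y i ω - Y j ω)]
      _ = s := by
          rw [integral_add ((hL2 i).integrable_sq.div_const 2)
            ((hL2 j).integrable_sq.div_const 2), integral_div, integral_div, hs, hs]
          ring
  have hrow (i : ℕ) : ∑ j ∈ A, ∫ ω, Y i ω * Y j ω ∂P ≤ (2 * m + 1) * s := by
    calc ∑ j ∈ A, ∫ ω, Y i ω * Y j ω ∂P
        ≤ ∑ j ∈ A, if j ∈ Icc (i - m) (i + m) then s else 0 := by
          refine sum_le_sum fun j _ => ?_
          split_ifs with hj
          · exact hle i j
          · rw [mem_Icc, not_and_or] at hj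
            rcases hj with hj | hj
            · simp_rw [mul_comm (Y i _)]
              exact (hzero j i (by omega)).le
            · exact (hzero i j (by omega)).le
      _ = #(A.filter (· ∈ Icc (i - m) (i + m))) * s := by
          rw [← sum_filter, sum_const, nsmul_eq_mul]
      _ ≤ (2 * m + 1) * s := by
          gcongr
          have h1 : #(A.filter (· ∈ Icc (i - m) (i + m))) ≤ #(Icc (i - m) (i + m)) :=
            card_le_card fun j hj => (mem_filter.1 hj).2
          rw [Nat.card_Icc] at h1
          have h2 : #(A.filter (· ∈ Icc (i - m) (i + m))) ≤ 2 * m + 1 := by omega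
          exact_mod_cast h2
  calc ∫ ω, (∑ i ∈ A, Y i ω) ^ 2 ∂P
      = ∑ i ∈ A, ∑ j ∈ A, ∫ ω, Y i ω * Y j ω ∂P := by
        simp_rw [sq, sum_mul_sum]
        rw [integral_finsetSum _ fun i _ => integrable_finsetSum _ fun j _ => hint i j]
        exact sum_congr rfl fun i _ => integral_finsetSum _ fun j _ => hint i j
    _ ≤ ∑ i ∈ A, (2 * m + 1) * s := sum_le_sum fun i _ => hrow i
    _ = (2 * m + 1) * s * #A := by rw [sum_const, nsmul_eq_mul]; ring

theorem integral_sq_sum_range_add (hL2 : ∀ i, MemLp (Y i) 2 P)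
    (hzero : ∀ i j, i + m < j → ∫ ω, Y i ω * Y j ω ∂P = 0)
    (hcov : ∀ n i, ∫ ω, Y n ω * Y (n + i) ω ∂P = ∫ ω, Y 0 ω * Y i ω ∂P) (n : ℕ) :
    ∫ ω, (∑ i ∈ range (m + n), Y i ω) ^ 2 ∂P = ∫ ω, (∑ i ∈ range m, Y i ω) ^ 2 ∂P +
      n * (∫ ω, Y 0 ω ^ 2 ∂P + 2 * ∑ i ∈ Icc 1 m, ∫ ω, Y 0 ω * Y i ω ∂P) := by
  have hint (i j : ℕ) : Integrable (fun ω => Y i ω * Y j ω) P := (hL2 i).integrable_mul (hL2 j)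
  induction n with
  | zero => simp
  | succ n ih =>
    have hcross : ∑ i ∈ range (m + n), ∫ ω, Y i ω * Y (m + n) ω ∂P =
        ∑ i ∈ Icc 1 m, ∫ ω, Y 0 ω * Y i ω ∂P := by
      have h1 : ∀ i ∈ range (m + n), ∫ ω, Y i ω * Y (m + n) ω ∂P =
          ∫ ω, Y 0 ω * Y (m + n - i) ω ∂P := fun i hi => by
        rw [mem_range] at hi
        rw [← hcov i (m + n - i), Nat.add_sub_cancel' hi.le]
      rw [sum_congr rfl h1]
      refine (sum_of_injOn (fun i => m + n - i) ?_ ?_ ?_ ?_).symm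
      · intro i hi j hj hij
        simp only [coe_Icc, Set.mem_Icc] at hi hj hij
        omega
      · intro i hi
        simp only [coe_Icc, Set.mem_Icc, coe_range, Set.mem_Iio] at hi ⊢
        omega
      · intro i hi hi'
        rw [mem_range] at hi
        refine hzero 0 _ ?_
        by_contra hlt
        refine hi' ⟨m + n - i, ?_, ?_⟩
        · simp only [coe_Icc, Set.mem_Icc]
          omega
        · dsimp only
          omega
      · intro i hi
        rw [mem_Icc] at hi
        rw [Nat.sub_sub_self (by omega)]
    have hsq (ω : Ω) : (∑ i ∈ range (m + (n + 1)), Y i ω) ^ 2 =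
        (∑ i ∈ range (m + n), Y i ω) ^ 2 +
          (2 * ∑ i ∈ range (m + n), Y i ω * Y (m + n) ω + Y (m + n) ω ^ 2) := by
      rw [← add_assoc, sum_range_succ, ← sum_mul]
      ring
    have hL (k : ℕ) : MemLp (fun ω => ∑ i ∈ range k, Y i ω) 2 P :=
      memLp_finsetSum _ fun i _ => hL2 i
    have hI : Integrable (fun ω => ∑ i ∈ range (m + n), Y i ω * Y (m + n) ω) P :=
      integrable_finsetSum _ fun i _ => hint i _
    have hadd : Integrable
        (fun ω => 2 * ∑ i ∈ range (m + n), Y i ω * Y (m + n) ω + Y (m + n) ω ^ 2) P :=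
      (hI.const_mul 2).add (hL2 _).integrable_sq
    simp_rw [hsq]
    rw [integral_add (hL _).integrable_sq hadd,
      integral_add (hI.const_mul 2) (hL2 _).integrable_sq, integral_const_mul,
      integral_finsetSum _ fun i _ => hint i _, hcross, ih]
    have hs : ∫ ω, Y (m + n) ω ^ 2 ∂P = ∫ ω, Y 0 ω ^ 2 ∂P := by
      simpa [sq] using hcov (m + n) 0
    rw [hs]
    push_cast
    ring

theorem charFun_map_sum_gappedBlocks [IsProbabilityMeasure P] (hmeas : ∀ i, AEMeasurable (Y i) P)
    (hind : ∀ A B : Finset ℕ, (∀ a ∈ A, ∀ b ∈ B, a + m < b) →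
      IndepFun (fun ω => ∑ i ∈ A, Y i ω) (fun ω => ∑ i ∈ B, Y i ω) P)
    (hident : ∀ n k, IdentDistrib (fun ω => ∑ i ∈ Ico n (n + k), Y i ω)
      (fun ω => ∑ i ∈ range k, Y i ω) P P) (p k : ℕ) (t : ℝ) :
    charFun (P.map fun ω => ∑ i ∈ gappedBlocks p m k, Y i ω) t =
      charFun (P.map fun ω => ∑ i ∈ range p, Y i ω) t ^ k := by
  induction k with
  | zero => simp [gappedBlocks, charFun_dirac]
  | succ k ih =>
    simp_rw [gappedBlocks, sum_union (disjoint_gappedBlocks_Ico p m k)]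
    rw [(hind _ _ fun a ha b hb => (add_lt_of_mem_gappedBlocks ha).trans_le
        (mem_Ico.1 hb).1).charFun_map_fun_add_eq_mul
      (Finset.aemeasurable_fun_sum _ fun i _ => hmeas i)
      (Finset.aemeasurable_fun_sum _ fun i _ => hmeas i),
      Pi.mul_apply, ih, (hident _ _).map_eq, pow_succ]

theorem integral_abs_sum_le [IsProbabilityMeasure P] (hL2 : ∀ i, MemLp (Y i) 2 P) {C : ℝ}
    (hC : ∀ A : Finset ℕ, ∫ ω, (∑ i ∈ A, Y i ω) ^ 2 ∂P ≤ C * #A) (A : Finset ℕ) :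
    ∫ ω, |∑ i ∈ A, Y i ω| ∂P ≤ √(C * #A) :=
  (integral_abs_le_sqrt_integral_sq (memLp_finsetSum _ fun i _ => hL2 i)).trans
    (Real.sqrt_le_sqrt (hC A))

theorem norm_charFun_sub_charFun_gappedBlocks_le [IsProbabilityMeasure P]
    (hL2 : ∀ i, MemLp (Y i) 2 P) {C : ℝ}
    (hC : ∀ A : Finset ℕ, ∫ ω, (∑ i ∈ A, Y i ω) ^ 2 ∂P ≤ C * #A) (hC0 : 0 ≤ C)
    {p N k : ℕ} (hk : 0 < k) (hp : 0 < p) (hkN : k * (p + m) ≤ N) (t : ℝ) :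
    ‖charFun (P.map fun ω => (√N)⁻¹ * ∑ i ∈ range N, Y i ω) t -
      charFun (P.map fun ω => (√(k * (p + m) : ℕ))⁻¹ * ∑ i ∈ gappedBlocks p m k, Y i ω) t‖ ≤
    |t| * (√(C * (1 - (k : ℝ) / N * p)) + |√((p + m) * ((k : ℝ) / N)) - 1| * √C) := by
  have hmeas (i : ℕ) : AEMeasurable (Y i) P := (hL2 i).aestronglyMeasurable.aemeasurable
  have hsum (A : Finset ℕ) : Integrable (fun ω => ∑ i ∈ A, Y i ω) P :=
    integrable_finsetSum _ fun i _ => (hL2 i).integrable one_le_two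
  have hsub : gappedBlocks p m k ⊆ range N := fun i hi => by
    have := add_lt_of_mem_gappedBlocks hi
    rw [mem_range]
    omega
  set A := gappedBlocks p m k with hA
  set R := range N \ A with hR
  have hM : 0 < k * (p + m) := by positivity
  have hN : 0 < (N : ℝ) := by exact_mod_cast hM.trans_le hkN
  have hcardA : (#A : ℝ) = k * p := by rw [hA, card_gappedBlocks]; push_cast; rfl
  have hcardR : (#R : ℝ) = N - k * p := by
    rw [hR, cast_card_sdiff hsub, hcardA, card_range]
  set α := (√N)⁻¹ with hα
  set β := (√(k * (p + m) : ℕ))⁻¹ with hβ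
  have hα0 : 0 ≤ α := by positivity
  have hdecomp (ω : Ω) : α * ∑ i ∈ range N, Y i ω - β * ∑ i ∈ A, Y i ω =
      α * ∑ i ∈ R, Y i ω + (α - β) * ∑ i ∈ A, Y i ω := by
    rw [← sum_sdiff hsub]
    ring
  refine (norm_charFun_map_sub_le (by fun_prop) (by fun_prop)
    (((hsum _).const_mul _).sub ((hsum _).const_mul _)) t).trans ?_
  gcongr
  calc ∫ ω, |α * ∑ i ∈ range N, Y i ω - β * ∑ i ∈ A, Y i ω| ∂P
      ≤ ∫ ω, (α * |∑ i ∈ R, Y i ω| + |α - β| * |∑ i ∈ A, Y i ω|) ∂P := by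
        refine integral_mono (((hsum _).const_mul _).sub ((hsum _).const_mul _)).abs
          (((hsum _).abs.const_mul _).add ((hsum _).abs.const_mul _)) fun ω => ?_
        dsimp only
        rw [hdecomp, ← abs_of_nonneg hα0, ← abs_mul, ← abs_mul, abs_of_nonneg hα0]
        exact abs_add_le _ _
    _ = α * ∫ ω, |∑ i ∈ R, Y i ω| ∂P + |α - β| * ∫ ω, |∑ i ∈ A, Y i ω| ∂P := by
        rw [integral_add ((hsum _).abs.const_mul _) ((hsum _).abs.const_mul _),
          integral_const_mul, integral_const_mul]
    _ ≤ α * √(C * #R) + |α - β| * √(C * (k * (p + m) : ℕ)) := by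
        gcongr
        · exact integral_abs_sum_le hL2 hC R
        · refine (integral_abs_sum_le hL2 hC A).trans (Real.sqrt_le_sqrt ?_)
          rw [hcardA]
          push_cast
          gcongr
          linarith [(Nat.cast_nonneg m : (0 : ℝ) ≤ m)]
    _ = √(C * (1 - (k : ℝ) / N * p)) + |√((p + m) * ((k : ℝ) / N)) - 1| * √C := by
        have hM' : 0 < √(k * (p + m) : ℕ) := Real.sqrt_pos.2 (by exact_mod_cast hM)
        congr 1
        · rw [hα, hcardR, ← Real.sqrt_inv, ← Real.sqrt_mul (by positivity)]
          congr 1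
          field_simp
        · rw [Real.sqrt_mul hC0, mul_comm √C, ← mul_assoc]
          congr 1
          rw [← abs_of_pos hM', ← abs_mul, sub_mul, hβ, inv_mul_cancel₀ hM'.ne',
            hα, ← Real.sqrt_inv, ← Real.sqrt_mul (by positivity)]
          congr 3
          push_cast
          ring

theorem tendsto_natDiv_div {q : ℕ} (hq : 0 < q) :
    Filter.Tendsto (fun N : ℕ => ((N / q : ℕ) : ℝ) / N) Filter.atTop (nhds (q : ℝ)⁻¹) := by
  have h := (tendsto_nat_floor_mul_div_atTop (R := ℝ) (a := (q : ℝ)⁻¹)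
    (by positivity)).comp tendsto_natCast_atTop_atTop
  refine h.congr fun N => ?_
  rw [Function.comp_apply, inv_mul_eq_div, Nat.floor_div_eq_div]

theorem tendsto_charFun_inv_sqrt_mul_sum_of_mDependent [IsProbabilityMeasure P]
    (hL2 : ∀ i, MemLp (Y i) 2 P) (hmean : ∀ i, ∫ ω, Y i ω ∂P = 0)
    (hind : ∀ A B : Finset ℕ, (∀ a ∈ A, ∀ b ∈ B, a + m < b) →
      IndepFun (fun ω => ∑ i ∈ A, Y i ω) (fun ω => ∑ i ∈ B, Y i ω) P)
    (hident : ∀ n k, IdentDistrib (fun ω => ∑ i ∈ Ico n (n + k), Y i ω)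
      (fun ω => ∑ i ∈ range k, Y i ω) P P)
    (hcov : ∀ n i, ∫ ω, Y n ω * Y (n + i) ω ∂P = ∫ ω, Y 0 ω * Y i ω ∂P) (t : ℝ) :
    Filter.Tendsto (fun N : ℕ => charFun (P.map fun ω => (√N)⁻¹ * ∑ i ∈ range N, Y i ω) t)
      Filter.atTop (nhds (Complex.exp ((-((∫ ω, Y 0 ω ^ 2 ∂P +
        2 * ∑ i ∈ Icc 1 m, ∫ ω, Y 0 ω * Y i ω ∂P) * t ^ 2 / 2) : ℝ)))) := by
  have hmeas (i : ℕ) : AEMeasurable (Y i) P := (hL2 i).aestronglyMeasurable.aemeasurable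
  have hzero (i j : ℕ) (hij : i + m < j) := integral_mul_eq_zero_of_add_lt hL2 hmean hind hij
  have hs (i : ℕ) : ∫ ω, Y i ω ^ 2 ∂P = ∫ ω, Y 0 ω ^ 2 ∂P := by
    simpa [sq] using hcov i 0
  have hvar := integral_sq_sum_range_add hL2 hzero hcov
  set v := ∫ ω, Y 0 ω ^ 2 ∂P + 2 * ∑ i ∈ Icc 1 m, ∫ ω, Y 0 ω * Y i ω ∂P
  set C := (2 * m + 1) * ∫ ω, Y 0 ω ^ 2 ∂P
  have hC0 : 0 ≤ C := mul_nonneg (by positivity) (integral_nonneg fun ω => sq_nonneg _)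
  have hC := integral_sq_sum_le hL2 hs hzero
  let p (n : ℕ) : ℕ := m + (n + 1)
  have hq (n : ℕ) : 0 < p n + m := by simp only [p]; omega
  have hbdd (n : ℕ) : ((p n + m : ℕ) : ℝ)⁻¹ * p n = 1 - ((p n + m : ℕ) : ℝ)⁻¹ * m := by
    have : ((p n + m : ℕ) : ℝ) ≠ 0 := by exact_mod_cast (hq n).ne'
    field_simp
    push_cast
    ring
  have hinv : Filter.Tendsto (fun n => ((p n + m : ℕ) : ℝ)⁻¹) Filter.atTop (nhds 0) := by
    refine tendsto_inv_atTop_zero.comp (tendsto_natCast_atTop_atTop.comp ?_)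
    exact Filter.tendsto_atTop_mono (fun n => show n ≤ p n + m by simp only [p]; omega)
      Filter.tendsto_id
  refine tendsto_of_forall_approx
    (G := fun n N => charFun (P.map fun ω => (√(N / (p n + m) * (p n + m) : ℕ))⁻¹ *
      ∑ i ∈ gappedBlocks (p n) m (N / (p n + m)), Y i ω) t)
    (h := fun n => Complex.exp ((-((∫ ω, (∑ i ∈ range (p n), Y i ω) ^ 2 ∂P) *
      ((√(p n + m : ℕ))⁻¹ * t) ^ 2 / 2) : ℝ)))
    (d := fun n N => |t| * (√(C * (1 - ((N / (p n + m) : ℕ) : ℝ) / N * p n)) +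
      |√((p n + m) * (((N / (p n + m) : ℕ) : ℝ) / N)) - 1| * √C))
    (e := fun n => |t| * (√(C * (1 - ((p n + m : ℕ) : ℝ)⁻¹ * p n)) +
      |√((p n + m) * ((p n + m : ℕ) : ℝ)⁻¹) - 1| * √C)) ?_ ?_ ?_ ?_ ?_
  · intro n
    have hZ : MemLp (fun ω => ∑ i ∈ range (p n), Y i ω) 2 P := memLp_finsetSum _ fun i _ => hL2 i
    have h0 : ∫ ω, ∑ i ∈ range (p n), Y i ω ∂P = 0 := by
      rw [integral_finsetSum _ fun i _ => (hL2 i).integrable one_le_two]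
      exact sum_eq_zero fun i _ => hmean i
    have key := (tendsto_charFun_inv_sqrt_mul_pow_of_integral_eq_zero hZ h0
      ((√(p n + m : ℕ))⁻¹ * t)).comp (Nat.tendsto_div_const_atTop (hq n).ne')
    refine key.congr fun N => ?_
    rw [Function.comp_apply, charFun_map_mul_comp (by fun_prop),
      charFun_map_sum_gappedBlocks hmeas hind hident, Nat.cast_mul,
      Real.sqrt_mul (Nat.cast_nonneg _), mul_inv, mul_assoc]
  · refine (Complex.continuous_exp.comp Complex.continuous_ofReal).continuousAt.tendsto.comp ?_
    have hlim : Filter.Tendsto (fun n => -((v + ((p n + m : ℕ) : ℝ)⁻¹ *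
        (∫ ω, (∑ i ∈ range m, Y i ω) ^ 2 ∂P - 2 * m * v)) * t ^ 2 / 2)) Filter.atTop
        (nhds (-((v + 0 * (∫ ω, (∑ i ∈ range m, Y i ω) ^ 2 ∂P - 2 * m * v)) * t ^ 2 / 2))) :=
      ((((hinv.mul_const _).const_add v).mul_const _).div_const _).neg
    rw [zero_mul, add_zero] at hlim
    refine hlim.congr fun n => ?_
    have hq0 : ((p n + m : ℕ) : ℝ) ≠ 0 := by exact_mod_cast (hq n).ne'
    rw [hvar (n + 1), mul_pow, inv_pow, Real.sq_sqrt (Nat.cast_nonneg _)]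
    field_simp
    simp only [p]
    push_cast
    ring
  · intro n
    filter_upwards [Filter.eventually_ge_atTop (p n + m)] with N hN
    exact norm_charFun_sub_charFun_gappedBlocks_le hL2 hC hC0 (Nat.div_pos hN (hq n))
      (by simp only [p]; omega) (Nat.div_mul_le_self _ _) t
  · intro n
    have hcont : Continuous fun x : ℝ => |t| * (√(C * (1 - x * p n)) +
        |√((p n + m) * x) - 1| * √C) := by fun_prop
    exact (hcont.tendsto _).comp (tendsto_natDiv_div (hq n))
  · have hcont : Continuous fun x : ℝ => |t| * √(C * (x * m)) := by fun_prop
    have hlim := (hcont.tendsto 0).comp hinv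
    simp only [zero_mul, mul_zero, Real.sqrt_zero] at hlim
    refine hlim.congr fun n => ?_
    have hq0 : ((p n : ℝ) + m) ≠ 0 := by exact_mod_cast (hq n).ne'
    rw [Function.comp_apply, hbdd, sub_sub_cancel, Nat.cast_add, mul_inv_cancel₀ hq0]
    simp

end CenteredSequence

/-- **Central limit theorem for strictly stationary `m`-dependent sequences
(Hoeffding–Robbins).** If `(X_n)` is strictly stationary and `m`-dependent with mean
`μ₀` and finite variance `σ²`, then `(1/√N)·Σ_{i=1}^{N}(X_i − μ₀)` converges in
distribution to `N(0, υ_m)` with `υ_m = σ² + 2·Σ_{i=1}^{m} Cov(X_t, X_{t+i})`. -/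
theorem hoeffding_robbins_clt
    {Ω : Type*} [MeasurableSpace Ω] (μ : Measure Ω) [IsProbabilityMeasure μ]
    (m : ℕ) (X : ℕ → Ω → ℝ) (hXmeas : ∀ i, Measurable (X i))
    (hL2 : ∀ i, MemLp (X i) 2 μ)
    -- strict stationarity: the law of `(X_{n+1},…,X_{n+k})` does not depend on `n`
    (hstat : ∀ n k : ℕ,
      IdentDistrib (fun ω => fun i : Fin k => X (n + (i : ℕ)) ω)
        (fun ω => fun i : Fin k => X (i : ℕ) ω) μ μ)
    -- `m`-dependence: `σ(X_j, j ≤ t)` and `σ(X_j, j ≥ t+m+1)` are independent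
    (hmdep : ∀ t : ℕ,
      Indep (⨆ j ∈ {j : ℕ | j ≤ t}, MeasurableSpace.comap (X j) inferInstance)
        (⨆ j ∈ {j : ℕ | t + m + 1 ≤ j}, MeasurableSpace.comap (X j) inferInstance) μ)
    (μ0 σ2 : ℝ) (hmean : ∀ i, ∫ ω, X i ω ∂μ = μ0)
    (hvar : ∀ i, variance (X i) μ = σ2)
    (v : NNReal)
    (hv : (v : ℝ) = σ2 + 2 * ∑ i ∈ Finset.Icc 1 m, ∫ ω, (X 0 ω - μ0) * (X i ω - μ0) ∂μ)
    (ν : ℕ → ProbabilityMeasure ℝ)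
    (hν : ∀ N : ℕ, (ν N : Measure ℝ) =
      μ.map (fun ω => (Real.sqrt N)⁻¹ * ∑ i ∈ Finset.range N, (X i ω - μ0)))
    (γ : ProbabilityMeasure ℝ) (hγ : (γ : Measure ℝ) = gaussianReal 0 v) :
    Filter.Tendsto ν Filter.atTop (nhds γ) := by
  have hY2 (i : ℕ) : MemLp (fun ω => X i ω - μ0) 2 μ := (hL2 i).sub (memLp_const μ0)
  have hY0 (i : ℕ) : ∫ ω, (X i ω - μ0) ∂μ = 0 := by
    rw [integral_sub ((hL2 i).integrable one_le_two) (integrable_const _), hmean]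
    simp
  have hident (n k : ℕ) : IdentDistrib (fun ω => ∑ i ∈ Ico n (n + k), (X i ω - μ0))
      (fun ω => ∑ i ∈ range k, (X i ω - μ0)) μ μ := by
    have h := (hstat n k).comp (u := fun x : Fin k → ℝ => ∑ i, (x i - μ0)) (by fun_prop)
    convert h using 1
    · ext ω
      rw [sum_Ico_eq_sum_range, Nat.add_sub_cancel_left, Function.comp_apply,
        Finset.sum_range fun i => X (n + i) ω - μ0]
    · ext ω
      rw [Function.comp_apply, Finset.sum_range fun i => X i ω - μ0]
  have hcov (n i : ℕ) : ∫ ω, (X n ω - μ0) * (X (n + i) ω - μ0) ∂μ =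
      ∫ ω, (X 0 ω - μ0) * (X i ω - μ0) ∂μ := by
    have h := (hstat n (i + 1)).comp
      (u := fun x : Fin (i + 1) → ℝ => (x 0 - μ0) * (x (Fin.last i) - μ0)) (by fun_prop)
    simpa [Function.comp_def] using h.integral_eq
  have hs : ∫ ω, (X 0 ω - μ0) ^ 2 ∂μ = σ2 := by
    rw [← hvar 0, variance_eq_integral (hXmeas 0).aemeasurable, hmean 0]
  refine ProbabilityMeasure.tendsto_iff_tendsto_charFun.2 fun t => ?_
  have key := tendsto_charFun_inv_sqrt_mul_sum_of_mDependent hY2 hY0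
    (fun A B hAB => indepFun_sum_of_indep_iSup hmdep μ0 hAB) hident hcov t
  rw [hs, ← hv] at key
  simp_rw [hν, hγ, charFun_gaussianReal]
  convert key using 3
  push_cast
  ring
end
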